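/- Let P be a 4-blocked point set. If some colour class of P consists of exactly four points in convex position, then P is {4,2,2,1}-blocked. -/

import Mathlib

/-- `x` blocks `v` and `w` if `x` lies strictly between `v` and `w`. -/
def Blocks {E : Type*} [AddCommGroup E] [Module ℝ E] (x v w : E) : Prop :=
  x ∈ openSegment ℝ v w

/-- `v` and `w` are visible with respect to `P` if no point of `P` blocks them. -/
def Visible {E : Type*} [AddCommGroup E] [Module ℝ E] (P : Set E) (v w : E) : Prop :=
  ∀ x ∈ P, ¬ Blocks x v w

/-- `c` is a blocked colouring of `P`: distinct points of `P` are visible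
iff they get different colours. -/
def BlockedColouring {E : Type*} [AddCommGroup E] [Module ℝ E] {k : ℕ}
    (P : Set E) (c : E → Fin k) : Prop :=
  ∀ v ∈ P, ∀ w ∈ P, v ≠ w → (Visible P v w ↔ c v ≠ c w)

/-- `P` is `k`-blocked. -/
def KBlocked {E : Type*} [AddCommGroup E] [Module ℝ E] (k : ℕ) (P : Set E) : Prop :=
  P.Finite ∧ ∃ c : E → Fin k, BlockedColouring P c

/-- `P` is `{n₁,…,n_k}`-blocked where `N` is the multiset of colour class sizes. -/
def IsNBlocked {E : Type*} [AddCommGroup E] [Module ℝ E] (N : Multiset ℕ) (P : Set E) : Prop :=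
  P.Finite ∧ ∃ (k : ℕ) (c : E → Fin k), BlockedColouring P c ∧
    N = Finset.univ.val.map (fun i : Fin k => (P ∩ c ⁻¹' {i}).ncard)

/-- A multiset of positive integers is representable if some planar point set is
`N`-blocked. -/
def Representable (N : Multiset ℕ) : Prop :=
  ∃ P : Set (ℝ × ℝ), IsNBlocked N P

/-- A set is in convex position if no point lies in the convex hull of the others. -/
def ConvexPosition {E : Type*} [AddCommGroup E] [Module ℝ E] (K : Set E) : Prop :=
  ∀ x ∈ K, x ∉ convexHull ℝ (K \ {x})

/-- `P` is `N`-midpoint-blocked: `N`-blocked, and midpoints of monochromatic pairs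
belong to `P`. -/
def IsNMidpointBlocked {E : Type*} [AddCommGroup E] [Module ℝ E]
    (N : Multiset ℕ) (P : Set E) : Prop :=
  P.Finite ∧ ∃ (k : ℕ) (c : E → Fin k), BlockedColouring P c ∧
    (∀ v ∈ P, ∀ w ∈ P, v ≠ w → c v = c w → midpoint ℝ v w ∈ P) ∧
    N = Finset.univ.val.map (fun i : Fin k => (P ∩ c ⁻¹' {i}).ncard)

section Collinear

variable {P : Set (ℝ × ℝ)} {k : ℕ} {c : ℝ × ℝ → Fin k}

lemma add_smul_mem_openSegment {p d : ℝ × ℝ} {r s t : ℝ} (hrs : r < s) (hst : s < t) :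
    p + s • d ∈ openSegment ℝ (p + r • d) (p + t • d) := by
  have h : 0 < t - r := by linarith
  refine ⟨(t - s) / (t - r), (s - r) / (t - r), div_pos (by linarith) h,
    div_pos (by linarith) h, by field_simp; ring, ?_⟩
  ext <;> simp <;> field_simp <;> ring

/-- Of three collinear points in a blocked set, the outer two share a colour
that the middle one does not have. -/
lemma BlockedColouring.colour_of_lt (hP : P.Finite) (hc : BlockedColouring P c)
    {p d : ℝ × ℝ} (hd : d ≠ 0) {r s t : ℝ} (hrs : r < s) (hst : s < t)
    (hr : p + r • d ∈ P) (hs : p + s • d ∈ P) (ht : p + t • d ∈ P) :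
    c (p + r • d) = c (p + t • d) ∧ c (p + s • d) ≠ c (p + r • d) := by
  have hinj : Function.Injective fun u : ℝ => p + u • d := fun u v h =>
    smul_left_injective ℝ hd (add_left_cancel h)
  have hout : ∀ {r s t : ℝ}, r < s → s < t → p + r • d ∈ P → p + s • d ∈ P → p + t • d ∈ P →
      c (p + r • d) = c (p + t • d) := fun {r s t} hrs hst hr hs ht => by
    by_contra hne
    exact (hc _ hr _ ht (hinj.ne (hrs.trans hst).ne)).2 hne _ hs
      (add_smul_mem_openSegment hrs hst)
  refine ⟨hout hrs hst hr hs ht, ?_⟩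
  have hfin : {u : ℝ | r < u ∧ p + u • d ∈ P}.Finite :=
    (hP.preimage hinj.injOn).subset fun u hu => hu.2
  obtain ⟨u, ⟨hru, hu⟩, hmin⟩ := Set.exists_min_image _ id hfin ⟨s, hrs, hs⟩
  have hcu : c (p + r • d) ≠ c (p + u • d) := by
    refine (hc _ hr _ hu (hinj.ne hru.ne)).1 ?_
    rintro _ hx ⟨α, β, hα, hβ, hαβ, rfl⟩
    obtain rfl : α = 1 - β := by linarith
    have hx' : (1 - β) • (p + r • d) + β • (p + u • d) = p + ((1 - β) * r + β * u) • d := by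
      ext <;> simp <;> ring
    rw [hx'] at hx
    have h1 : u ≤ (1 - β) * r + β * u :=
      hmin ((1 - β) * r + β * u) ⟨by nlinarith [mul_pos hβ (sub_pos.2 hru)], hx⟩
    nlinarith [mul_pos hα (sub_pos.2 hru)]
  rcases (show u ≤ s from hmin s ⟨hrs, hs⟩).eq_or_lt with rfl | hus
  · exact hcu.symm
  · exact absurd ((hout hrs hst hr hs ht).trans (hout hus hst hu hs ht).symm) hcu

/-- No line contains four points of a blocked set. -/
lemma BlockedColouring.not_four_collinear (hP : P.Finite) (hc : BlockedColouring P c)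
    {p d : ℝ × ℝ} (hd : d ≠ 0) {r s t u : ℝ} (hrs : r < s) (hst : s < t) (htu : t < u)
    (hr : p + r • d ∈ P) (hs : p + s • d ∈ P) (ht : p + t • d ∈ P) (hu : p + u • d ∈ P) :
    False := by
  have h₁ := hc.colour_of_lt hP hd hrs (hst.trans htu) hr hs hu
  have h₂ := hc.colour_of_lt hP hd hst htu hs ht hu
  exact h₁.2 (h₂.1.trans h₁.1.symm)

lemma BlockedColouring.colour_of_mem_openSegment (hP : P.Finite) (hc : BlockedColouring P c)
    {v w m : ℝ × ℝ} (hv : v ∈ P) (hw : w ∈ P) (hm : m ∈ P) (hne : v ≠ w)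
    (h : m ∈ openSegment ℝ v w) : c v = c w ∧ c m ≠ c v := by
  obtain ⟨t, ⟨h0, h1⟩, rfl⟩ := openSegment_eq_image' ℝ v w ▸ h
  simpa using hc.colour_of_lt hP (p := v) (d := w - v) (sub_ne_zero.2 hne.symm) h0 h1
    (by simpa using hv) hm (by simpa using hw)

/-- Two distinct points of the same colour are blocked by a point of another colour. -/
lemma BlockedColouring.exists_blocker (hP : P.Finite) (hc : BlockedColouring P c)
    {v w : ℝ × ℝ} (hv : v ∈ P) (hw : w ∈ P) (hne : v ≠ w) (h : c v = c w) :
    ∃ m ∈ P, m ∈ openSegment ℝ v w ∧ c m ≠ c v := by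
  have h1 : ¬ Visible P v w := fun h' => (hc v hv w hw hne).1 h' h
  simp only [Visible, Blocks, not_forall, not_not] at h1
  obtain ⟨m, hm, hb⟩ := h1
  exact ⟨m, hm, hb, (hc.colour_of_mem_openSegment hP hv hw hm hne hb).2⟩

/-- There are no four points of a blocked set in the order `y, z, x, w` on a line. -/
lemma BlockedColouring.not_overlap (hP : P.Finite) (hc : BlockedColouring P c)
    {y z x w : ℝ × ℝ} (hy : y ∈ P) (hz : z ∈ P) (hx : x ∈ P) (hw : w ∈ P) (hne : y ≠ x)
    (h₁ : z ∈ openSegment ℝ y x) (h₂ : x ∈ openSegment ℝ z w) : False := by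
  obtain ⟨t, ⟨h0, h1⟩, rfl⟩ := openSegment_eq_image' ℝ y x ▸ h₁
  obtain ⟨α, β, hα, hβ, hαβ, h⟩ := h₂
  have hw' : w = y + ((1 - α * t) / β) • (x - y) := by
    obtain rfl : α = 1 - β := by linarith
    have e1 := congrArg Prod.fst h
    have e2 := congrArg Prod.snd h
    simp at e1 e2
    ext
    · simp; field_simp; linear_combination e1
    · simp; field_simp; linear_combination e2
  have hu : 1 < (1 - α * t) / β := by
    rw [lt_div_iff₀ hβ]; nlinarith
  exact hc.not_four_collinear hP (p := y) (d := x - y) (sub_ne_zero.2 hne.symm) h0 h1 hu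
    (by simpa using hy) hz (by simpa using hx) (hw' ▸ hw)

/-- A point of a blocked set blocks at most one pair with a given end point. -/
lemma BlockedColouring.eq_of_mem_openSegment (hP : P.Finite) (hc : BlockedColouring P c)
    {w x y m : ℝ × ℝ} (hw : w ∈ P) (hx : x ∈ P) (hy : y ∈ P) (hm : m ∈ P) (hne : x ≠ w)
    (h₁ : x ∈ openSegment ℝ y w) (h₂ : x ∈ openSegment ℝ m w) : y = m := by
  have key : ∀ {z}, x ∈ openSegment ℝ z w → ∃ t : ℝ, 1 < t ∧ z = w + t • (x - w) := by
    rintro z ⟨α, β, hα, hβ, hαβ, rfl⟩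
    obtain rfl : β = 1 - α := by linarith
    refine ⟨1 / α, by rw [lt_div_iff₀ hα]; linarith, ?_⟩
    ext <;> simp <;> field_simp <;> ring
  obtain ⟨s, hs, rfl⟩ := key h₁
  obtain ⟨t, ht, rfl⟩ := key h₂
  have hd : x - w ≠ 0 := sub_ne_zero.2 hne
  rcases lt_trichotomy s t with hst | rfl | hst
  · exact (hc.not_four_collinear hP hd zero_lt_one hs hst (by simpa using hw)
      (by simpa using hx) hy hm).elim
  · rfl
  · exact (hc.not_four_collinear hP hd zero_lt_one ht hst (by simpa using hw)
      (by simpa using hx) hm hy).elim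

/-- Twice the signed area of the triangle `pqr`. -/
def signedArea (p q r : ℝ × ℝ) : ℝ :=
  (q.1 - p.1) * (r.2 - p.2) - (q.2 - p.2) * (r.1 - p.1)

lemma signedArea_rotate (p q r : ℝ × ℝ) : signedArea q r p = signedArea p q r := by
  unfold signedArea; ring

lemma ne_of_signedArea_ne_zero {p q r : ℝ × ℝ} (h : signedArea p q r ≠ 0) :
    p ≠ q ∧ p ≠ r ∧ q ≠ r := by
  refine ⟨?_, ?_, ?_⟩ <;> rintro rfl <;> apply h <;> unfold signedArea <;> ring

lemma exists_eq_add_smul_of_signedArea_eq_zero {p q r : ℝ × ℝ} (hpq : p ≠ q)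
    (h : signedArea p q r = 0) : ∃ t : ℝ, r = p + t • (q - p) := by
  have hpos : 0 < (q.1 - p.1) ^ 2 + (q.2 - p.2) ^ 2 := by
    by_contra hle
    have h1 : q.1 - p.1 = 0 := by nlinarith [sq_nonneg (q.1 - p.1), sq_nonneg (q.2 - p.2)]
    have h2 : q.2 - p.2 = 0 := by nlinarith [sq_nonneg (q.1 - p.1), sq_nonneg (q.2 - p.2)]
    exact hpq (Prod.ext (by linarith) (by linarith))
  unfold signedArea at h
  refine ⟨((r.1 - p.1) * (q.1 - p.1) + (r.2 - p.2) * (q.2 - p.2)) /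
    ((q.1 - p.1) ^ 2 + (q.2 - p.2) ^ 2), ?_⟩
  ext
  · simp; field_simp; linear_combination (-(q.2 - p.2)) * h
  · simp; field_simp; linear_combination (q.1 - p.1) * h

/-- Three distinct points of the same colour are not collinear. -/
lemma BlockedColouring.signedArea_ne_zero (hP : P.Finite) (hc : BlockedColouring P c)
    {p q r : ℝ × ℝ} (hp : p ∈ P) (hq : q ∈ P) (hr : r ∈ P) (hpq : p ≠ q) (hpr : p ≠ r)
    (hqr : q ≠ r) (h₁ : c p = c q) (h₂ : c p = c r) : signedArea p q r ≠ 0 := by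
  intro h
  obtain ⟨t, rfl⟩ := exists_eq_add_smul_of_signedArea_eq_zero hpq h
  have ht0 : t ≠ 0 := by rintro rfl; simp at hpr
  have ht1 : t ≠ 1 := by rintro rfl; simp at hqr
  let T : Finset ℝ := {0, 1, t}
  have hT : T.card = 3 := by simp [T, Finset.card_insert_of_notMem, ht0.symm, ht1.symm]
  have hmem : ∀ u ∈ T, p + u • (q - p) ∈ P ∧ c (p + u • (q - p)) = c p := by
    simp only [T, Finset.mem_insert, Finset.mem_singleton]
    rintro u (rfl | rfl | rfl)
    · simpa using hp
    · simpa using ⟨hq, h₁.symm⟩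
    · exact ⟨hr, h₂.symm⟩
  let f := T.orderEmbOfFin hT
  have hf := fun j => hmem (f j) (T.orderEmbOfFin_mem hT j)
  exact (hc.colour_of_lt hP (sub_ne_zero.2 hpq.symm) (f.strictMono (by decide : (0 : Fin 3) < 1))
    (f.strictMono (by decide : (1 : Fin 3) < 2)) (hf 0).1 (hf 1).1 (hf 2).1).2
      ((hf 1).2.trans (hf 0).2.symm)

end Collinear

section ThreeColours

variable {Q : Set (ℝ × ℝ)} {c : ℝ × ℝ → Fin 4} {i : Fin 4}

lemma fin_four_eq : ∀ i j k l m : Fin 4, i ≠ j → i ≠ k → j ≠ k → l ≠ i → l ≠ j → l ≠ k →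
    m ≠ i → m ≠ j → m ≠ k → l = m := by decide

lemma exists_eq_of_mem_openSegment {v w m : ℝ × ℝ} (h : m ∈ openSegment ℝ v w) :
    ∃ t : ℝ, 0 < t ∧ t < 1 ∧ m = (1 - t) • v + t • w := by
  obtain ⟨α, β, hα, hβ, hαβ, rfl⟩ := h
  exact ⟨β, hβ, by linarith, by rw [← hαβ]; simp⟩

lemma combo_mem_Ioo {t x y : ℝ} (ht0 : 0 < t) (ht1 : t < 1) (hx : x ∈ Set.Ioo (0 : ℝ) 1)
    (hy : y ∈ Set.Ioo (0 : ℝ) 1) : (1 - t) * x + t * y ∈ Set.Ioo (0 : ℝ) 1 :=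
  convex_Ioo (0 : ℝ) 1 hx hy (sub_pos.2 ht1).le ht0.le (by ring)

lemma mul_mem_Ioo {x y : ℝ} (hx : x ∈ Set.Ioo (0 : ℝ) 1) (hy : y ∈ Set.Ioo (0 : ℝ) 1) :
    x * y ∈ Set.Ioo (0 : ℝ) 1 :=
  ⟨mul_pos hx.1 hy.1, mul_lt_one_of_nonneg_of_lt_one_left hx.1.le hx.2 hy.2.le⟩

/-- If the triangle `uvw` has the least area among nondegenerate monochromatic triangles, then
the blockers of its sides cannot be coloured with exactly two colours. -/
lemma BlockedColouring.not_two_coloured_blockers (hQ : Q.Finite) (hc : BlockedColouring Q c)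
    (hi : ∀ q ∈ Q, c q ≠ i) {u v w p q r : ℝ × ℝ} (hu : u ∈ Q) (hv : v ∈ Q)
    (hp : p ∈ Q) (hq : q ∈ Q) (hr : r ∈ Q) (huv : c u = c v)
    (hD : signedArea u v w ≠ 0)
    (hmin : ∀ p ∈ Q, ∀ q ∈ Q, ∀ r ∈ Q, c p = c q → c p = c r → signedArea p q r ≠ 0 →
      |signedArea u v w| ≤ |signedArea p q r|)
    (hpo : p ∈ openSegment ℝ v w) (hqo : q ∈ openSegment ℝ w u) (hro : r ∈ openSegment ℝ u v)
    (hcp : c p ≠ c u) (hcr : c r ≠ c u) (hpq : c p = c q) (hpr : c p ≠ c r) : False := by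
  have small : ∀ {κ : ℝ} {x y z : ℝ × ℝ}, x ∈ Q → y ∈ Q → z ∈ Q → c x = c y → c x = c z →
      signedArea x y z = κ * signedArea u v w → κ ∈ Set.Ioo (0 : ℝ) 1 → False := by
    intro κ x y z hx hy hz hxy hxz h h0
    have := hmin x hx y hy z hz hxy hxz (h ▸ mul_ne_zero h0.1.ne' hD)
    rw [h, abs_mul, abs_of_pos h0.1] at this
    nlinarith [abs_pos.2 hD, h0.2]
  obtain ⟨a, ha0, ha1, hpa⟩ := exists_eq_of_mem_openSegment hpo
  obtain ⟨b, hb0, hb1, hqb⟩ := exists_eq_of_mem_openSegment hqo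
  obtain ⟨d, hd0, hd1, hrd⟩ := exists_eq_of_mem_openSegment hro
  have ha : a ∈ Set.Ioo (0 : ℝ) 1 := ⟨ha0, ha1⟩
  have hb : 1 - b ∈ Set.Ioo (0 : ℝ) 1 := ⟨by linarith, by linarith⟩
  have hinner : signedArea r p q =
      ((1 - a) * ((1 - b) * (1 - d)) + a * (b * d)) * signedArea u v w := by
    subst hpa hqb hrd
    simp [signedArea]; ring
  have hκ : (1 - a) * ((1 - b) * (1 - d)) + a * (b * d) ∈ Set.Ioo (0 : ℝ) 1 :=
    combo_mem_Ioo ha0 ha1 (mul_mem_Ioo hb ⟨by linarith, by linarith⟩)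
      (mul_mem_Ioo ⟨hb0, hb1⟩ ⟨hd0, hd1⟩)
  obtain ⟨-, hpq'⟩ := ne_of_signedArea_ne_zero (hinner ▸ mul_ne_zero hκ.1.ne' hD)
  obtain ⟨s, hs, hso, hcs⟩ := hc.exists_blocker hQ hp hq hpq'.2 hpq
  obtain ⟨e, he0, he1, hse⟩ := exists_eq_of_mem_openSegment hso
  have hsD : signedArea s u v = ((1 - e) * a + e * (1 - b)) * signedArea u v w := by
    subst hse hpa hqb
    simp [signedArea]; ring
  have hsκ := combo_mem_Ioo he0 he1 ha hb
  have hcsu : c s ≠ c u := fun h => small hs hu hv h (h.trans huv) hsD hsκ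
  have hcsr : c s = c r := fin_four_eq i (c u) (c p) _ _ (hi u hu).symm (hi p hp).symm hcp.symm
    (hi s hs) hcsu hcs (hi r hr) hcr hpr.symm
  have hsr : s ≠ r := by
    rintro rfl
    refine mul_ne_zero hsκ.1.ne' hD (hsD.symm.trans ?_)
    subst hrd
    simp [signedArea]; ring
  obtain ⟨t, ht, hto, hct⟩ := hc.exists_blocker hQ hs hr hsr hcsr
  obtain ⟨f, hf0, hf1, htf⟩ := exists_eq_of_mem_openSegment hto
  have hf : 1 - f ∈ Set.Ioo (0 : ℝ) 1 := ⟨by linarith, by linarith⟩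
  have hctu : c t ≠ c u := fun h => by
    refine small ht hu hv h (h.trans huv) (κ := (1 - f) * ((1 - e) * a + e * (1 - b))) ?_
      (mul_mem_Ioo hf hsκ)
    rw [mul_assoc, ← hsD]
    subst htf hrd
    simp [signedArea]; ring
  have hctp : c t = c p := fin_four_eq i (c u) (c r) _ _ (hi u hu).symm (hi r hr).symm hcr.symm
    (hi t ht) hctu (hcsr ▸ hct) (hi p hp) hcp hpr
  refine small ht hp hq hctp (hctp.trans hpq) (κ := f * ((1 - a) * ((1 - b) * (1 - d)) +
    a * (b * d))) ?_ (mul_mem_Ioo ⟨hf0, hf1⟩ hκ)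
  rw [mul_assoc, ← hinner]
  subst htf hse
  simp [signedArea]; ring

/-- In a set blocked with at most three colours, each colour is used at most twice. -/
theorem BlockedColouring.not_monochromatic_triple (hQ : Q.Finite) (hc : BlockedColouring Q c)
    (hi : ∀ q ∈ Q, c q ≠ i) {p q r : ℝ × ℝ} (hp : p ∈ Q) (hq : q ∈ Q) (hr : r ∈ Q)
    (hpq : p ≠ q) (hpr : p ≠ r) (hqr : q ≠ r) (h₁ : c p = c q) (h₂ : c p = c r) : False := by
  let M : Set ((ℝ × ℝ) × (ℝ × ℝ) × (ℝ × ℝ)) := {τ | (τ.1 ∈ Q ∧ τ.2.1 ∈ Q ∧ τ.2.2 ∈ Q) ∧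
    c τ.1 = c τ.2.1 ∧ c τ.1 = c τ.2.2 ∧ signedArea τ.1 τ.2.1 τ.2.2 ≠ 0}
  have hM : M.Finite := (hQ.prod (hQ.prod hQ)).subset fun τ hτ => hτ.1
  obtain ⟨⟨u, v, w⟩, ⟨⟨hu, hv, hw⟩, huv, huw, hD⟩, hmin'⟩ := Set.exists_min_image M
    (fun τ => |signedArea τ.1 τ.2.1 τ.2.2|) hM
    ⟨(p, q, r), ⟨hp, hq, hr⟩, h₁, h₂, hc.signedArea_ne_zero hQ hp hq hr hpq hpr hqr h₁ h₂⟩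
  dsimp only at hu hv hw huv huw hD
  have hmin : ∀ p ∈ Q, ∀ q ∈ Q, ∀ r ∈ Q, c p = c q → c p = c r → signedArea p q r ≠ 0 →
      |signedArea u v w| ≤ |signedArea p q r| := fun p hp q hq r hr h₁ h₂ h =>
    hmin' (p, q, r) ⟨⟨hp, hq, hr⟩, h₁, h₂, h⟩
  obtain ⟨nuv, nuw, nvw⟩ := ne_of_signedArea_ne_zero hD
  obtain ⟨x, hx, hxo, hcx⟩ := hc.exists_blocker hQ hv hw nvw (huv.symm.trans huw)
  obtain ⟨y, hy, hyo, hcy⟩ := hc.exists_blocker hQ hw hu nuw.symm huw.symm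
  obtain ⟨z, hz, hzo, hcz⟩ := hc.exists_blocker hQ hu hv nuv huv
  rw [← huv] at hcx
  rw [← huw] at hcy
  have e₁ := signedArea_rotate u v w
  have e₂ := (signedArea_rotate v w u).trans e₁
  by_cases hxy : c x = c y
  · by_cases hxz : c x = c z
    · obtain ⟨a, ha0, ha1, rfl⟩ := exists_eq_of_mem_openSegment hxo
      obtain ⟨b, hb0, hb1, rfl⟩ := exists_eq_of_mem_openSegment hyo
      obtain ⟨d, hd0, hd1, rfl⟩ := exists_eq_of_mem_openSegment hzo
      have hκ : (1 - a) * ((1 - b) * (1 - d)) + a * (b * d) ∈ Set.Ioo (0 : ℝ) 1 :=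
        combo_mem_Ioo ha0 ha1 (mul_mem_Ioo ⟨by linarith, by linarith⟩ ⟨by linarith, by linarith⟩)
          (mul_mem_Ioo ⟨hb0, hb1⟩ ⟨hd0, hd1⟩)
      have h : signedArea ((1 - a) • v + a • w) ((1 - b) • w + b • u) ((1 - d) • u + d • v) =
          ((1 - a) * ((1 - b) * (1 - d)) + a * (b * d)) * signedArea u v w := by
        simp [signedArea]; ring
      have := hmin _ hx _ hy _ hz hxy hxz (h ▸ mul_ne_zero hκ.1.ne' hD)
      rw [h, abs_mul, abs_of_pos hκ.1] at this
      nlinarith [abs_pos.2 hD, hκ.2]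
    · exact hc.not_two_coloured_blockers hQ hi hu hv hx hy hz huv hD hmin hxo hyo hzo hcx hcz
        hxy hxz
  · by_cases hxz : c x = c z
    · exact hc.not_two_coloured_blockers hQ hi hw hu hz hx hy huw.symm (e₂ ▸ hD) (e₂ ▸ hmin)
        hzo hxo hyo (huw ▸ hcz) (huw ▸ hcy) hxz.symm (hxz ▸ hxy)
    · have hyz : c y = c z := fin_four_eq i (c u) (c x) _ _ (hi u hu).symm (hi x hx).symm hcx.symm
        (hi y hy) hcy (Ne.symm hxy) (hi z hz) hcz (Ne.symm hxz)
      exact hc.not_two_coloured_blockers hQ hi hv hw hy hz hx (huv.symm.trans huw) (e₁ ▸ hD)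
        (e₁ ▸ hmin) hyo hzo hxo (huv ▸ hcy) (huv ▸ hcx) hyz (Ne.symm hxy)

/-- Three monochromatic pairs `uᵢ, vᵢ`, each blocked by a point of the next one. -/
structure Pinwheel (c : ℝ × ℝ → Fin 4) (u₁ v₁ u₂ v₂ u₃ v₃ : ℝ × ℝ) : Prop where
  mem₁ : u₂ ∈ openSegment ℝ u₁ v₁
  mem₂ : u₃ ∈ openSegment ℝ u₂ v₂
  mem₃ : u₁ ∈ openSegment ℝ u₃ v₃
  eq₁ : c v₁ = c u₁
  eq₂ : c v₂ = c u₂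
  eq₃ : c v₃ = c u₃
  ne₁₂ : c u₁ ≠ c u₂
  ne₂₃ : c u₂ ≠ c u₃
  ne₃₁ : c u₃ ≠ c u₁

lemma Pinwheel.rotate {u₁ v₁ u₂ v₂ u₃ v₃ : ℝ × ℝ} (h : Pinwheel c u₁ v₁ u₂ v₂ u₃ v₃) :
    Pinwheel c u₂ v₂ u₃ v₃ u₁ v₁ :=
  ⟨h.mem₂, h.mem₃, h.mem₁, h.eq₂, h.eq₃, h.eq₁, h.ne₂₃, h.ne₃₁, h.ne₁₂⟩

/-- A set blocked with three colours in which every colour is repeated is a pinwheel. -/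
lemma BlockedColouring.exists_pinwheel (hQ : Q.Finite) (hc : BlockedColouring Q c)
    (hi : ∀ q ∈ Q, c q ≠ i) (hmate : ∀ p ∈ Q, ∃ q ∈ Q, q ≠ p ∧ c q = c p) (hne : Q.Nonempty) :
    ∃ u₁ v₁ u₂ v₂ u₃ v₃, Pinwheel c u₁ v₁ u₂ v₂ u₃ v₃ ∧
      ∀ p ∈ Q, p = u₁ ∨ p = v₁ ∨ p = u₂ ∨ p = v₂ ∨ p = u₃ ∨ p = v₃ := by
  have two : ∀ {p q}, p ∈ Q → q ∈ Q → q ≠ p → c q = c p → ∀ {r}, r ∈ Q → c r = c p →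
      r = p ∨ r = q := by
    intro p q hp hq hqp h r hr hrp
    by_contra! hcon
    exact hc.not_monochromatic_triple hQ hi hp hq hr hqp.symm hcon.1.symm hcon.2.symm
      h.symm hrp.symm
  obtain ⟨a, ha⟩ := hne
  obtain ⟨b, hb, hba, hcb⟩ := hmate a ha
  obtain ⟨u₂, hu₂, hm₁, hcu₂⟩ := hc.exists_blocker hQ ha hb hba.symm hcb.symm
  obtain ⟨v₂, hv₂, hne₂, hcv₂⟩ := hmate u₂ hu₂
  obtain ⟨u₃, hu₃, hm₂, hcu₃⟩ := hc.exists_blocker hQ hu₂ hv₂ hne₂.symm hcv₂.symm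
  have hcu₃a : c u₃ ≠ c a := by
    intro h
    rcases two ha hb hba hcb hu₃ h with rfl | rfl
    · exact hc.not_overlap hQ hv₂ hu₃ hu₂ hb hne₂ (by rwa [openSegment_symm]) hm₁
    · exact hc.not_overlap hQ hv₂ hu₃ hu₂ ha hne₂ (by rwa [openSegment_symm])
        (by rwa [openSegment_symm])
  obtain ⟨v₃, hv₃, hne₃, hcv₃⟩ := hmate u₃ hu₃
  obtain ⟨u₁, hu₁, hm₃, hcu₁⟩ := hc.exists_blocker hQ hu₃ hv₃ hne₃.symm hcv₃.symm
  have hcu₁₂ : c u₁ ≠ c u₂ := by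
    intro h
    rcases two hu₂ hv₂ hne₂ hcv₂ hu₁ h with rfl | rfl
    · exact hc.not_overlap hQ hv₃ hu₁ hu₃ hv₂ hne₃ (by rwa [openSegment_symm]) hm₂
    · exact hc.not_overlap hQ hv₃ hu₁ hu₃ hu₂ hne₃ (by rwa [openSegment_symm])
        (by rwa [openSegment_symm])
  have hcu₁a : c u₁ = c a := fin_four_eq i (c u₂) (c u₃) _ _ (hi u₂ hu₂).symm (hi u₃ hu₃).symm
    hcu₃.symm (hi u₁ hu₁) hcu₁₂ hcu₁ (hi a ha) hcu₂.symm hcu₃a.symm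
  obtain ⟨v₁, hv₁, hne₁, hcv₁, hm₁'⟩ : ∃ v₁ ∈ Q, v₁ ≠ u₁ ∧ c v₁ = c u₁ ∧
      u₂ ∈ openSegment ℝ u₁ v₁ := by
    rcases two ha hb hba hcb hu₁ hcu₁a with rfl | rfl
    · exact ⟨b, hb, hba, hcb, hm₁⟩
    · exact ⟨a, ha, hba.symm, hcb.symm, by rwa [openSegment_symm]⟩
  refine ⟨u₁, v₁, u₂, v₂, u₃, v₃, ⟨hm₁', hm₂, hm₃, hcv₁, hcv₂, hcv₃, hcu₁₂, hcu₃.symm,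
    hcu₁.symm⟩, fun p hp => ?_⟩
  by_cases h1 : c p = c u₁
  · have := two hu₁ hv₁ hne₁ hcv₁ hp h1; tauto
  by_cases h2 : c p = c u₂
  · have := two hu₂ hv₂ hne₂ hcv₂ hp h2; tauto
  have h3 : c p = c u₃ := fin_four_eq i (c u₁) (c u₂) _ _ (hi u₁ hu₁).symm (hi u₂ hu₂).symm hcu₁₂
    (hi p hp) h1 h2 (hi u₃ hu₃) hcu₁.symm hcu₃
  have := two hu₃ hv₃ hne₃ hcv₃ hp h3; tauto

/-- Every point of `F` is strictly separated from the others by a line through it. -/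
def StrictlyExposed (F : Finset (ℝ × ℝ)) : Prop :=
  ∀ p ∈ F, ∃ l : ℝ × ℝ →ᵃ[ℝ] ℝ, l p = 0 ∧ ∀ q ∈ F, q ≠ p → l q < 0

lemma AffineMap.neg_of_mem_openSegment (l : ℝ × ℝ →ᵃ[ℝ] ℝ) {m v w : ℝ × ℝ}
    (hm : m ∈ openSegment ℝ v w) (hv : l v ≤ 0) (hw : l w < 0) : l m < 0 := by
  obtain ⟨α, β, hα, hβ, hαβ, rfl⟩ := hm
  rw [Convex.combo_affine_apply hαβ, smul_eq_mul, smul_eq_mul]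
  nlinarith

lemma Pinwheel.notMem {u₁ v₁ u₂ v₂ u₃ v₃ : ℝ × ℝ} (h : Pinwheel c u₁ v₁ u₂ v₂ u₃ v₃)
    {F : Finset (ℝ × ℝ)} (hF : StrictlyExposed F) :
    ¬ (u₁ ∈ F ∧ u₂ ∈ F ∧ v₁ ∈ F) ∧ ¬ (v₃ ∈ F ∧ v₁ ∈ F ∧ u₂ ∈ F ∧ u₃ ∈ F) ∧
      ¬ (v₁ ∈ F ∧ v₂ ∈ F ∧ v₃ ∈ F ∧ u₁ ∈ F) := by
  obtain ⟨m₁, m₂, m₃, e₁, e₂, e₃, n₁, n₂, n₃⟩ := h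
  have ne {p q} : c p ≠ c q → p ≠ q := ne_of_apply_ne c
  have n21 : v₁ ≠ u₂ := ne (e₁ ▸ n₁)
  have n23 : v₃ ≠ u₂ := ne (e₃ ▸ n₂.symm)
  have n12 : v₂ ≠ u₁ := ne (e₂ ▸ n₁.symm)
  have n13 : v₃ ≠ u₁ := ne (e₃ ▸ n₃)
  refine ⟨?_, ?_, ?_⟩
  · rintro ⟨h1, h2, h3⟩
    obtain ⟨l, h0, hl⟩ := hF _ h2
    exact (l.neg_of_mem_openSegment m₁ (hl _ h1 (ne n₁)).le (hl _ h3 n21)).ne h0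
  · rintro ⟨h1, h2, h3, h4⟩
    obtain ⟨l, h0, hl⟩ := hF _ h3
    have := l.neg_of_mem_openSegment m₃ (hl _ h4 (ne n₂.symm)).le (hl _ h1 n23)
    exact (l.neg_of_mem_openSegment m₁ this.le (hl _ h2 n21)).ne h0
  · rintro ⟨h1, h2, h3, h4⟩
    obtain ⟨l, h0, hl⟩ := hF _ h4
    have hv₁ : v₁ ≠ u₁ := by
      rintro rfl
      rw [openSegment_same] at m₁
      exact n21 (Set.mem_singleton_iff.1 m₁).symm
    have i₁ := l.neg_of_mem_openSegment m₁ h0.le (hl _ h1 hv₁)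
    have i₂ := l.neg_of_mem_openSegment m₂ i₁.le (hl _ h2 n12)
    exact (l.neg_of_mem_openSegment m₃ i₂.le (hl _ h3 n13)).ne h0

lemma card_inter_insert_le {α : Type*} [DecidableEq α] (F S : Finset α) (a : α) :
    (F ∩ insert a S).card ≤ (if a ∈ F then 1 else 0) + (F ∩ S).card := by
  split_ifs with h
  · rw [Finset.inter_insert_of_mem h, add_comm]
    exact Finset.card_insert_le _ _
  · rw [Finset.inter_insert_of_notMem h, zero_add]

lemma Pinwheel.card_le_three {u₁ v₁ u₂ v₂ u₃ v₃ : ℝ × ℝ} (h : Pinwheel c u₁ v₁ u₂ v₂ u₃ v₃)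
    {F : Finset (ℝ × ℝ)} (hF : StrictlyExposed F)
    (hsub : ∀ p ∈ F, p = u₁ ∨ p = v₁ ∨ p = u₂ ∨ p = v₂ ∨ p = u₃ ∨ p = v₃) : F.card ≤ 3 := by
  have k₁ := h.notMem hF
  have k₂ := h.rotate.notMem hF
  have k₃ := h.rotate.rotate.notMem hF
  have hF' : F ∩ {u₁, v₁, u₂, v₂, u₃, v₃} = F :=
    Finset.inter_eq_left.2 fun p hp => by simpa using hsub p hp
  have c₁ := card_inter_insert_le F {v₁, u₂, v₂, u₃, v₃} u₁
  have c₂ := card_inter_insert_le F {u₂, v₂, u₃, v₃} v₁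
  have c₃ := card_inter_insert_le F {v₂, u₃, v₃} u₂
  have c₄ := card_inter_insert_le F {u₃, v₃} v₂
  have c₅ := card_inter_insert_le F {v₃} u₃
  have c₆ := card_inter_insert_le F ∅ v₃
  rw [hF'] at c₁
  simp only [Finset.inter_empty, Finset.card_empty, insert_empty_eq] at c₆
  by_cases a₁ : u₁ ∈ F <;> by_cases a₂ : u₂ ∈ F <;> by_cases a₃ : u₃ ∈ F <;>
  by_cases b₁ : v₁ ∈ F <;> by_cases b₂ : v₂ ∈ F <;> by_cases b₃ : v₃ ∈ F <;>
    simp only [a₁, a₂, a₃, b₁, b₂, b₃, if_true, if_false, and_true, and_false,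
      not_true, not_false_iff] at k₁ k₂ k₃ c₁ c₂ c₃ c₄ c₅ c₆ <;> omega

/-- A set blocked with at most three colours and containing four points in strictly convex
position has at most five points. -/
theorem BlockedColouring.card_le_five (hQ : Q.Finite) (hc : BlockedColouring Q c)
    (hi : ∀ q ∈ Q, c q ≠ i) {F : Finset (ℝ × ℝ)} (hFQ : ∀ p ∈ F, p ∈ Q) (hF : StrictlyExposed F)
    (hcard : F.card = 4) : Q.ncard ≤ 5 := by
  by_contra! hlt
  obtain ⟨G, rfl⟩ : ∃ G : Finset (ℝ × ℝ), (G : Set (ℝ × ℝ)) = Q := ⟨hQ.toFinset, hQ.coe_toFinset⟩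
  rw [Set.ncard_coe_finset] at hlt
  have hmate : ∀ p ∈ (G : Set (ℝ × ℝ)), ∃ q ∈ (G : Set (ℝ × ℝ)), q ≠ p ∧ c q = c p := by
    intro p hp
    by_contra! hcon
    have hmaps : ∀ q ∈ G.erase p, c q ∈ (Finset.univ \ {i, c p} : Finset (Fin 4)) := by
      intro q hq
      obtain ⟨hqp, hq⟩ := Finset.mem_erase.1 hq
      simpa using ⟨hi q hq, hcon q hq hqp⟩
    have hcard2 : (Finset.univ \ {i, c p} : Finset (Fin 4)).card = 2 := by
      rw [Finset.card_univ_sdiff, Finset.card_pair (hi p hp).symm, Fintype.card_fin]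
    obtain ⟨j, -, hj⟩ := Finset.exists_lt_card_fiber_of_mul_lt_card_of_maps_to hmaps
      (n := 2) (by rw [hcard2, Finset.card_erase_of_mem hp]; omega)
    obtain ⟨x, y, z, hx, hy, hz, hxy, hxz, hyz⟩ := Finset.two_lt_card_iff.1 hj
    simp only [Finset.mem_filter, Finset.mem_erase] at hx hy hz
    exact hc.not_monochromatic_triple hQ hi hx.1.2 hy.1.2 hz.1.2 hxy hxz hyz
      (hx.2.trans hy.2.symm) (hx.2.trans hz.2.symm)
  obtain ⟨u₁, v₁, u₂, v₂, u₃, v₃, h, hall⟩ := hc.exists_pinwheel hQ hi hmate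
    (Finset.coe_nonempty.2 (Finset.card_pos.1 (by omega)))
  have := h.card_le_three hF fun p hp => hall p (hFQ p hp)
  omega

end ThreeColours

section Quadrilateral

/-- The lines `l₁ = 0, …, l₄ = 0` carry the sides of the convex quadrilateral `p₁p₂p₃p₄`, with
equations normalized so that `l₁ + l₃ = l₂ + l₄`. -/
structure QuadFrame (p₁ p₂ p₃ p₄ : ℝ × ℝ) (l₁ l₂ l₃ l₄ : ℝ × ℝ →ᵃ[ℝ] ℝ) : Prop where
  z₁₁ : l₁ p₁ = 0
  z₁₂ : l₁ p₂ = 0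
  n₁₃ : l₁ p₃ < 0
  n₁₄ : l₁ p₄ < 0
  z₂₂ : l₂ p₂ = 0
  z₂₃ : l₂ p₃ = 0
  n₂₄ : l₂ p₄ < 0
  n₂₁ : l₂ p₁ < 0
  z₃₃ : l₃ p₃ = 0
  z₃₄ : l₃ p₄ = 0
  n₃₁ : l₃ p₁ < 0
  n₃₂ : l₃ p₂ < 0
  z₄₄ : l₄ p₄ = 0
  z₄₁ : l₄ p₁ = 0
  n₄₂ : l₄ p₂ < 0
  n₄₃ : l₄ p₃ < 0
  sum : ∀ p, l₁ p + l₃ p = l₂ p + l₄ p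
  inj₁ : ∀ p q, l₄ p = l₄ q → l₁ p = l₁ q → p = q
  inj₂ : ∀ p q, l₁ p = l₁ q → l₂ p = l₂ q → p = q
  inj₃ : ∀ p q, l₂ p = l₂ q → l₃ p = l₃ q → p = q
  inj₄ : ∀ p q, l₃ p = l₃ q → l₄ p = l₄ q → p = q

/-- The region bounded by four lines. -/
def quadRegion (l₁ l₂ l₃ l₄ : ℝ × ℝ →ᵃ[ℝ] ℝ) : Set (ℝ × ℝ) :=
  {p | l₁ p ≤ 0 ∧ l₂ p ≤ 0 ∧ l₃ p ≤ 0 ∧ l₄ p ≤ 0}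

variable {p₁ p₂ p₃ p₄ : ℝ × ℝ} {l₁ l₂ l₃ l₄ : ℝ × ℝ →ᵃ[ℝ] ℝ}

lemma QuadFrame.rotate (h : QuadFrame p₁ p₂ p₃ p₄ l₁ l₂ l₃ l₄) :
    QuadFrame p₂ p₃ p₄ p₁ l₂ l₃ l₄ l₁ where
  z₁₁ := h.z₂₂
  z₁₂ := h.z₂₃
  n₁₃ := h.n₂₄
  n₁₄ := h.n₂₁
  z₂₂ := h.z₃₃
  z₂₃ := h.z₃₄
  n₂₄ := h.n₃₁
  n₂₁ := h.n₃₂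
  z₃₃ := h.z₄₄
  z₃₄ := h.z₄₁
  n₃₁ := h.n₄₂
  n₃₂ := h.n₄₃
  z₄₄ := h.z₁₁
  z₄₁ := h.z₁₂
  n₄₂ := h.n₁₃
  n₄₃ := h.n₁₄
  sum p := by linarith [h.sum p]
  inj₁ := h.inj₂
  inj₂ := h.inj₃
  inj₃ := h.inj₄
  inj₄ := h.inj₁

lemma quadRegion_rotate : quadRegion l₂ l₃ l₄ l₁ = quadRegion l₁ l₂ l₃ l₄ := by
  ext p; simp only [quadRegion, Set.mem_ofPred_eq]; tauto

lemma convex_quadRegion : Convex ℝ (quadRegion l₁ l₂ l₃ l₄) := by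
  have h : ∀ l : ℝ × ℝ →ᵃ[ℝ] ℝ, Convex ℝ {p | l p ≤ 0} := fun l =>
    (convex_Iic (0 : ℝ)).affine_preimage l
  exact (h l₁).inter ((h l₂).inter ((h l₃).inter (h l₄)))

lemma AffineMap.eq_zero_of_mem_openSegment (l : ℝ × ℝ →ᵃ[ℝ] ℝ) {m v w : ℝ × ℝ}
    (hm : m ∈ openSegment ℝ v w) (hv : l v = 0) (hw : l w = 0) : l m = 0 := by
  obtain ⟨α, β, hα, hβ, hαβ, rfl⟩ := hm
  simp [Convex.combo_affine_apply hαβ, hv, hw]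

lemma AffineMap.pos_of_mem_openSegment (l : ℝ × ℝ →ᵃ[ℝ] ℝ) {m v w : ℝ × ℝ}
    (hm : m ∈ openSegment ℝ v w) (hv : 0 ≤ l v) (hw : 0 < l w) : 0 < l m := by
  have := AffineMap.neg_of_mem_openSegment (-l) hm (by simpa using hv) (by simpa using hw)
  simpa using this

lemma AffineMap.eq_zero_of_mem_openSegment_of_nonpos (l : ℝ × ℝ →ᵃ[ℝ] ℝ) {m v w : ℝ × ℝ}
    (hm : m ∈ openSegment ℝ v w) (h : l m = 0) (hv : l v ≤ 0) (hw : l w ≤ 0) : l v = 0 := by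
  by_contra hne
  exact (l.neg_of_mem_openSegment (openSegment_symm ℝ v w ▸ hm) hw (lt_of_le_of_ne hv hne)).ne h

/-- The vertices of the quadrilateral are extreme points of its region. -/
lemma QuadFrame.vertex_notMem_openSegment (h : QuadFrame p₁ p₂ p₃ p₄ l₁ l₂ l₃ l₄) {v w : ℝ × ℝ}
    (hv : v ∈ quadRegion l₁ l₂ l₃ l₄) (hw : w ∈ quadRegion l₁ l₂ l₃ l₄) (hne : v ≠ p₁) :
    p₁ ∉ openSegment ℝ v w := fun hm =>
  hne (h.inj₁ _ _ ((l₄.eq_zero_of_mem_openSegment_of_nonpos hm h.z₄₁ hv.2.2.2 hw.2.2.2).trans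
    h.z₄₁.symm) ((l₁.eq_zero_of_mem_openSegment_of_nonpos hm h.z₁₁ hv.1 hw.1).trans h.z₁₁.symm))

/-- A side of the quadrilateral is cut by the equations of the four sides. -/
lemma QuadFrame.side (h : QuadFrame p₁ p₂ p₃ p₄ l₁ l₂ l₃ l₄) {m : ℝ × ℝ}
    (hm : m ∈ openSegment ℝ p₁ p₂) : l₁ m = 0 ∧ l₂ m < 0 ∧ l₃ m < 0 ∧ l₄ m < 0 :=
  ⟨l₁.eq_zero_of_mem_openSegment hm h.z₁₁ h.z₁₂,
    l₂.neg_of_mem_openSegment (openSegment_symm ℝ p₁ p₂ ▸ hm) h.z₂₂.le h.n₂₁,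
    l₃.neg_of_mem_openSegment hm h.n₃₁.le h.n₃₂,
    l₄.neg_of_mem_openSegment hm h.z₄₁.le h.n₄₂⟩

lemma QuadFrame.diagonal (h : QuadFrame p₁ p₂ p₃ p₄ l₁ l₂ l₃ l₄) {m : ℝ × ℝ}
    (hm : m ∈ openSegment ℝ p₁ p₃) : l₁ m < 0 ∧ l₂ m < 0 ∧ l₃ m < 0 ∧ l₄ m < 0 :=
  ⟨l₁.neg_of_mem_openSegment hm h.z₁₁.le h.n₁₃,
    l₂.neg_of_mem_openSegment (openSegment_symm ℝ p₁ p₃ ▸ hm) h.z₂₃.le h.n₂₁,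
    l₃.neg_of_mem_openSegment (openSegment_symm ℝ p₁ p₃ ▸ hm) h.z₃₃.le h.n₃₁,
    l₄.neg_of_mem_openSegment hm h.z₄₁.le h.n₄₃⟩

/-- The affine function `p ↦ α p.1 + β p.2 + γ`. -/
def affineForm (α β γ : ℝ) : ℝ × ℝ →ᵃ[ℝ] ℝ :=
  (α • AffineMap.fst + β • AffineMap.snd) + AffineMap.const ℝ (ℝ × ℝ) γ

lemma affineForm_apply (α β γ : ℝ) (p : ℝ × ℝ) :
    affineForm α β γ p = α * p.1 + β * p.2 + γ := by
  simp [affineForm]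

/-- The frame of a quadrilateral in affine coordinates whose axes are the diagonals. -/
lemma quadFrame_of_coordinates {S T : ℝ × ℝ →ᵃ[ℝ] ℝ} {κ μ : ℝ} (hκ : 0 < κ) (hμ : 0 < μ)
    (hST : ∀ p q, S p = S q → T p = T q → p = q) (s₁ : S p₁ = 1) (t₁ : T p₁ = 0)
    (s₂ : S p₂ = 0) (t₂ : T p₂ = 1) (s₃ : S p₃ = -1 / κ) (t₃ : T p₃ = 0) (s₄ : S p₄ = 0)
    (t₄ : T p₄ = -1 / μ) :
    ∃ l₁ l₂ l₃ l₄, QuadFrame p₁ p₂ p₃ p₄ l₁ l₂ l₃ l₄ := by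
  let l (α β : ℝ) : ℝ × ℝ →ᵃ[ℝ] ℝ := α • S + β • T + AffineMap.const ℝ (ℝ × ℝ) (-1)
  have hl (α β : ℝ) (p : ℝ × ℝ) : l α β p = α * S p + β * T p - 1 := by
    simp [l]; ring
  refine ⟨l 1 1, l (-κ) 1, l (-κ) (-μ), l 1 (-μ), ?_⟩
  constructor
  case sum => intro p; simp only [hl]; ring
  case inj₁ | inj₃ =>
    intro p q h h'
    simp only [hl] at h h'
    have : T p = T q := mul_left_cancel₀ (by positivity : 1 + μ ≠ 0) (by linarith)
    rw [this] at h
    refine hST p q ?_ this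
    first
      | linarith
      | exact mul_left_cancel₀ hκ.ne' (by linarith)
  case inj₂ | inj₄ =>
    intro p q h h'
    simp only [hl] at h h'
    have : S p = S q := mul_left_cancel₀ (by positivity : 1 + κ ≠ 0) (by linarith)
    rw [this] at h
    refine hST p q this ?_
    first
      | linarith
      | exact mul_left_cancel₀ hμ.ne' (by linarith)
  all_goals
    simp only [hl, s₁, s₂, s₃, s₄, t₁, t₂, t₃, t₄]
    field_simp
    linarith

/-- A nondegenerate quadrilateral with crossing diagonals has a frame. -/
lemma exists_quadFrame {z : ℝ × ℝ} (h₁₃ : z ∈ openSegment ℝ p₁ p₃)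
    (h₂₄ : z ∈ openSegment ℝ p₂ p₄) (hD : signedArea p₁ p₂ p₃ ≠ 0) :
    ∃ l₁ l₂ l₃ l₄, QuadFrame p₁ p₂ p₃ p₄ l₁ l₂ l₃ l₄ := by
  obtain ⟨a, ha0, ha1, hz⟩ := exists_eq_of_mem_openSegment h₁₃
  obtain ⟨b, hb0, hb1, hz'⟩ := exists_eq_of_mem_openSegment h₂₄
  obtain ⟨u, v, hu, hv⟩ : ∃ u v : ℝ × ℝ, p₁ = z + u ∧ p₂ = z + v :=
    ⟨p₁ - z, p₂ - z, by abel, by abel⟩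
  have ha : 0 < 1 - a := by linarith
  have hb : 0 < 1 - b := by linarith
  have opposite : ∀ {t : ℝ} {p q w : ℝ × ℝ}, 0 < t → z = (1 - t) • p + t • q → p = z + w →
      q = z - ((1 - t) / t) • w := by
    intro t p q w ht h hp
    have e1 := congrArg Prod.fst h
    have e2 := congrArg Prod.snd h
    simp [hp] at e1 e2
    ext
    · simp; field_simp; linear_combination -e1
    · simp; field_simp; linear_combination -e2
  have hp₃ := opposite ha0 hz hu
  have hp₄ := opposite hb0 hz' hv
  set Δ := u.1 * v.2 - u.2 * v.1 with hΔ
  have hΔ0 : Δ ≠ 0 := by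
    intro h0
    apply hD
    have : a * signedArea p₁ p₂ p₃ = Δ := by
      rw [hp₃, hu, hv, hΔ]
      simp [signedArea]; field_simp; ring
    rw [h0] at this
    simpa [ha0.ne'] using this
  let S := affineForm (v.2 / Δ) (-v.1 / Δ) ((z.2 * v.1 - z.1 * v.2) / Δ)
  let T := affineForm (-u.2 / Δ) (u.1 / Δ) ((z.1 * u.2 - z.2 * u.1) / Δ)
  have hS (s t : ℝ) : S (z + s • u + t • v) = s := by
    simp only [S, affineForm_apply]; simp; field_simp; rw [hΔ]; ring
  have hT (s t : ℝ) : T (z + s • u + t • v) = t := by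
    simp only [T, affineForm_apply]; simp; field_simp; rw [hΔ]; ring
  have hST (p : ℝ × ℝ) : p = z + S p • u + T p • v := by
    ext
    · simp [S, T, affineForm_apply]; field_simp; rw [hΔ]; ring
    · simp [S, T, affineForm_apply]; field_simp; rw [hΔ]; ring
  have e₁ : p₁ = z + (1 : ℝ) • u + (0 : ℝ) • v := by simp [hu]
  have e₂ : p₂ = z + (0 : ℝ) • u + (1 : ℝ) • v := by simp [hv]
  have e₃ : p₃ = z + (-1 / (a / (1 - a))) • u + (0 : ℝ) • v := by
    rw [hp₃, show -1 / (a / (1 - a)) = -((1 - a) / a) by field_simp]; simp [sub_eq_add_neg]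
  have e₄ : p₄ = z + (0 : ℝ) • u + (-1 / (b / (1 - b))) • v := by
    rw [hp₄, show -1 / (b / (1 - b)) = -((1 - b) / b) by field_simp]; simp [sub_eq_add_neg]
  exact quadFrame_of_coordinates (S := S) (T := T) (div_pos ha0 ha) (div_pos hb0 hb)
    (fun p q h h' => by rw [hST p, hST q, h, h'])
    (by rw [e₁, hS]) (by rw [e₁, hT]) (by rw [e₂, hS]) (by rw [e₂, hT]) (by rw [e₃, hS])
    (by rw [e₃, hT]) (by rw [e₄, hS]) (by rw [e₄, hT])

/-- The vertices of a convex quadrilateral can be labelled so that the diagonals cross. -/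
lemma ConvexPosition.exists_crossing {K : Set (ℝ × ℝ)} (hK : ConvexPosition K)
    (hcard : K.ncard = 4) : ∃ p₁ p₂ p₃ p₄ z : ℝ × ℝ, K = {p₁, p₂, p₃, p₄} ∧ p₁ ≠ p₂ ∧ p₁ ≠ p₃ ∧
      p₂ ≠ p₃ ∧ z ∈ openSegment ℝ p₁ p₃ ∧ z ∈ openSegment ℝ p₂ p₄ := by
  have hfin : K.Finite := Set.finite_of_ncard_ne_zero (by omega)
  obtain ⟨f, hf⟩ : ∃ f : Fin 4 → ℝ × ℝ, Function.Injective f ∧ Set.range f = K := by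
    have : Fintype K := hfin.fintype
    have e := Fintype.equivFinOfCardEq (α := K) (n := 4)
      (by rw [← Nat.card_eq_fintype_card]; exact hcard)
    exact ⟨fun j => e.symm j, Subtype.val_injective.comp e.symm.injective, by
      rw [show (fun j => (e.symm j : ℝ × ℝ)) = Subtype.val ∘ e.symm from rfl,
        Set.range_comp, e.symm.surjective.range_eq]; simp⟩
  obtain ⟨hinj, rfl⟩ := hf
  have hdep : ¬ AffineIndependent ℝ f := by
    intro h
    have := h.card_le_finrank_succ
    have h2 : Module.finrank ℝ (vectorSpan ℝ (Set.range f)) ≤ Module.finrank ℝ (ℝ × ℝ) :=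
      Submodule.finrank_le _
    simp at this h2
    omega
  obtain ⟨I, z, hz, hz'⟩ := Convex.radon_partition hdep
  have notMem : ∀ (J : Set (Fin 4)) (j : Fin 4), J = {j} → z ∈ convexHull ℝ (f '' J) →
      z ∈ convexHull ℝ (f '' Jᶜ) → False := by
    rintro _ j rfl h h'
    rw [Set.image_singleton, convexHull_singleton, Set.mem_singleton_iff] at h
    subst h
    refine hK _ ⟨j, rfl⟩ (convexHull_mono ?_ h')
    rintro _ ⟨k, hk, rfl⟩
    exact ⟨⟨k, rfl⟩, fun h => hk (hinj h)⟩
  have hpos : ∀ J : Set (Fin 4), z ∈ convexHull ℝ (f '' J) → J.ncard ≠ 0 := by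
    intro J h h0
    rw [Set.ncard_eq_zero] at h0
    simp [h0] at h
  have hsum := Set.ncard_add_ncard_compl I
  rw [Nat.card_eq_fintype_card, Fintype.card_fin] at hsum
  have h1 : I.ncard ≠ 1 := fun h => by
    obtain ⟨j, hj⟩ := Set.ncard_eq_one.1 h
    exact notMem I j hj hz hz'
  have h3 : Iᶜ.ncard ≠ 1 := fun h => by
    obtain ⟨j, hj⟩ := Set.ncard_eq_one.1 h
    exact notMem Iᶜ j hj hz' (by rwa [compl_compl])
  have h0 := hpos I hz
  have h4 := hpos _ hz'
  obtain ⟨i, k, hik, hI⟩ := Set.ncard_eq_two.1 (show I.ncard = 2 by omega)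
  obtain ⟨j, l, hjl, hIc⟩ := Set.ncard_eq_two.1 (show Iᶜ.ncard = 2 by omega)
  have hj : j ∉ I := by rw [← Set.mem_compl_iff, hIc]; simp
  have hl : l ∉ I := by rw [← Set.mem_compl_iff, hIc]; simp
  rw [hI, Set.mem_insert_iff, Set.mem_singleton_iff, not_or] at hj hl
  rw [hI, Set.image_pair, convexHull_pair] at hz
  rw [hIc, Set.image_pair, convexHull_pair] at hz'
  have hopen : ∀ {a b d e : Fin 4}, a ≠ d → a ≠ e → b ≠ d → b ≠ e →
      z ∈ segment ℝ (f a) (f b) → z ∈ segment ℝ (f d) (f e) → z ∈ openSegment ℝ (f a) (f b) := by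
    intro a b d e had hae hbd hbe h h'
    have hout : ∀ {a}, a ≠ d → a ≠ e → z ≠ f a := by
      rintro a had hae rfl
      refine hK _ ⟨a, rfl⟩ (convexHull_mono ?_ (convexHull_pair (𝕜 := ℝ) (f d) (f e) ▸ h'))
      rintro _ (rfl | rfl)
      · exact ⟨⟨d, rfl⟩, fun h => had (hinj h).symm⟩
      · exact ⟨⟨e, rfl⟩, fun h => hae (hinj h).symm⟩
    exact mem_openSegment_of_ne_left_right (hout had hae).symm (hout hbd hbe).symm h
  refine ⟨f i, f j, f k, f l, z, ?_, hinj.ne (Ne.symm hj.1), hinj.ne hik, hinj.ne hj.2,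
    hopen (Ne.symm hj.1) (Ne.symm hl.1) (Ne.symm hj.2) (Ne.symm hl.2) hz hz',
    hopen hj.1 hj.2 hl.1 hl.2 hz' hz⟩
  rw [← Set.image_univ, ← Set.union_compl_self I, hI, ← hI, hIc, hI]
  simp only [Set.image_union, Set.image_pair]
  ext p; simp; tauto

end Quadrilateral

section NinePoints

variable {P : Set (ℝ × ℝ)} {c : ℝ × ℝ → Fin 4} {i : Fin 4}
  {p₁ p₂ p₃ p₄ m₁ m₂ m₃ m₄ x : ℝ × ℝ} {l₁ l₂ l₃ l₄ : ℝ × ℝ →ᵃ[ℝ] ℝ}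

lemma AffineMap.left_pos_of_mem_openSegment (l : ℝ × ℝ →ᵃ[ℝ] ℝ) {m v w : ℝ × ℝ}
    (hm : m ∈ openSegment ℝ v w) (h : l m = 0) (hw : l w < 0) : 0 < l v := by
  by_contra! hv
  exact (l.neg_of_mem_openSegment hm hv hw).ne h

lemma AffineMap.left_neg_of_mem_openSegment (l : ℝ × ℝ →ᵃ[ℝ] ℝ) {m v w : ℝ × ℝ}
    (hm : m ∈ openSegment ℝ v w) (h : l m < 0) (hw : l w = 0) : l v < 0 := by
  obtain ⟨α, β, hα, hβ, hαβ, rfl⟩ := hm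
  rw [Convex.combo_affine_apply hαβ, smul_eq_mul, smul_eq_mul, hw] at h
  by_contra! hv
  nlinarith

lemma QuadFrame.mem_region (h : QuadFrame p₁ p₂ p₃ p₄ l₁ l₂ l₃ l₄) :
    p₁ ∈ quadRegion l₁ l₂ l₃ l₄ :=
  ⟨h.z₁₁.le, h.n₂₁.le, h.n₃₁.le, h.z₄₁.le⟩

/-- A blocked set whose colour class `i` is the vertex set of the quadrilateral `p₁p₂p₃p₄`, and
whose other points in the quadrilateral are one point `mⱼ` on each side and the crossing point
`x` of the diagonals. -/
structure NinePoint (P : Set (ℝ × ℝ)) (c : ℝ × ℝ → Fin 4) (i : Fin 4)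
    (p₁ p₂ p₃ p₄ m₁ m₂ m₃ m₄ x : ℝ × ℝ) (l₁ l₂ l₃ l₄ : ℝ × ℝ →ᵃ[ℝ] ℝ) : Prop where
  finite : P.Finite
  blocked : BlockedColouring P c
  frame : QuadFrame p₁ p₂ p₃ p₄ l₁ l₂ l₃ l₄
  vertex : ∀ q, q ∈ P ∧ c q = i ↔ q = p₁ ∨ q = p₂ ∨ q = p₃ ∨ q = p₄
  mem₁ : m₁ ∈ P
  mem₂ : m₂ ∈ P
  mem₃ : m₃ ∈ P
  mem₄ : m₄ ∈ P
  memₓ : x ∈ P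
  side₁ : m₁ ∈ openSegment ℝ p₁ p₂
  side₂ : m₂ ∈ openSegment ℝ p₂ p₃
  side₃ : m₃ ∈ openSegment ℝ p₃ p₄
  side₄ : m₄ ∈ openSegment ℝ p₄ p₁
  diag₁ : x ∈ openSegment ℝ p₁ p₃
  diag₂ : x ∈ openSegment ℝ p₂ p₄
  ne₁ : c m₁ ≠ i
  ne₂ : c m₂ ≠ i
  ne₃ : c m₃ ≠ i
  ne₄ : c m₄ ≠ i
  neₓ : c x ≠ i
  complete : ∀ q ∈ P, q ∈ quadRegion l₁ l₂ l₃ l₄ → c q ≠ i →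
    q = m₁ ∨ q = m₂ ∨ q = m₃ ∨ q = m₄ ∨ q = x

lemma NinePoint.rotate (h : NinePoint P c i p₁ p₂ p₃ p₄ m₁ m₂ m₃ m₄ x l₁ l₂ l₃ l₄) :
    NinePoint P c i p₂ p₃ p₄ p₁ m₂ m₃ m₄ m₁ x l₂ l₃ l₄ l₁ where
  finite := h.finite
  blocked := h.blocked
  frame := h.frame.rotate
  vertex q := by rw [h.vertex]; tauto
  mem₁ := h.mem₂
  mem₂ := h.mem₃
  mem₃ := h.mem₄
  mem₄ := h.mem₁
  memₓ := h.memₓ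
  side₁ := h.side₂
  side₂ := h.side₃
  side₃ := h.side₄
  side₄ := h.side₁
  diag₁ := h.diag₂
  diag₂ := openSegment_symm ℝ p₁ p₃ ▸ h.diag₁
  ne₁ := h.ne₂
  ne₂ := h.ne₃
  ne₃ := h.ne₄
  ne₄ := h.ne₁
  neₓ := h.neₓ
  complete q hq hR hi := by
    have := h.complete q hq (quadRegion_rotate ▸ hR) hi
    tauto

/-- No vertex of the quadrilateral blocks two of the other points in it. -/
lemma QuadFrame.colour_ne_of_mem_openSegment (h : QuadFrame p₁ p₂ p₃ p₄ l₁ l₂ l₃ l₄)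
    (hvert : ∀ q, q ∈ P ∧ c q = i ↔ q = p₁ ∨ q = p₂ ∨ q = p₃ ∨ q = p₄) {v w z : ℝ × ℝ}
    (hv : v ∈ quadRegion l₁ l₂ l₃ l₄) (hw : w ∈ quadRegion l₁ l₂ l₃ l₄) (hvi : c v ≠ i)
    (hz : z ∈ P) (hzo : z ∈ openSegment ℝ v w) : c z ≠ i := by
  intro hzi
  have hne : v ≠ z := by rintro rfl; exact hvi hzi
  have r₁ := @quadRegion_rotate l₁ l₂ l₃ l₄
  have r₂ := (@quadRegion_rotate l₂ l₃ l₄ l₁).trans r₁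
  have r₃ := (@quadRegion_rotate l₃ l₄ l₁ l₂).trans r₂
  rcases (hvert z).1 ⟨hz, hzi⟩ with rfl | rfl | rfl | rfl
  · exact h.vertex_notMem_openSegment hv hw hne hzo
  · exact h.rotate.vertex_notMem_openSegment (r₁ ▸ hv) (r₁ ▸ hw) hne hzo
  · exact h.rotate.rotate.vertex_notMem_openSegment (r₂ ▸ hv) (r₂ ▸ hw) hne hzo
  · exact h.rotate.rotate.rotate.vertex_notMem_openSegment (r₃ ▸ hv) (r₃ ▸ hw) hne hzo

lemma NinePoint.ne_m₁₂ (h : NinePoint P c i p₁ p₂ p₃ p₄ m₁ m₂ m₃ m₄ x l₁ l₂ l₃ l₄) :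
    m₁ ≠ m₂ := by
  rintro rfl
  exact (h.frame.rotate.side h.side₂).2.2.2.ne (h.frame.side h.side₁).1

lemma NinePoint.ne_m₁₃ (h : NinePoint P c i p₁ p₂ p₃ p₄ m₁ m₂ m₃ m₄ x l₁ l₂ l₃ l₄) :
    m₁ ≠ m₃ := by
  rintro rfl
  exact (h.frame.side h.side₁).2.2.1.ne (h.frame.rotate.rotate.side h.side₃).1

lemma NinePoint.side_mem_region
    (h : NinePoint P c i p₁ p₂ p₃ p₄ m₁ m₂ m₃ m₄ x l₁ l₂ l₃ l₄) :
    m₁ ∈ quadRegion l₁ l₂ l₃ l₄ := by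
  obtain ⟨e, e₂, e₃, e₄⟩ := h.frame.side h.side₁
  exact ⟨e.le, e₂.le, e₃.le, e₄.le⟩

lemma NinePoint.region_rotations :
    quadRegion l₂ l₃ l₄ l₁ = quadRegion l₁ l₂ l₃ l₄ ∧
    quadRegion l₃ l₄ l₁ l₂ = quadRegion l₁ l₂ l₃ l₄ ∧
    quadRegion l₄ l₁ l₂ l₃ = quadRegion l₁ l₂ l₃ l₄ := by
  have r₁ := @quadRegion_rotate l₁ l₂ l₃ l₄
  have r₂ := (@quadRegion_rotate l₂ l₃ l₄ l₁).trans r₁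
  exact ⟨r₁, r₂, (@quadRegion_rotate l₃ l₄ l₁ l₂).trans r₂⟩

lemma NinePoint.center_mem_region
    (h : NinePoint P c i p₁ p₂ p₃ p₄ m₁ m₂ m₃ m₄ x l₁ l₂ l₃ l₄) :
    x ∈ quadRegion l₁ l₂ l₃ l₄ := by
  obtain ⟨e₁, e₂, e₃, e₄⟩ := h.frame.diagonal h.diag₁
  exact ⟨e₁.le, e₂.le, e₃.le, e₄.le⟩

/-- Two points of the quadrilateral of the same colour, not vertices, are blocked by one of
the five other points. -/
lemma NinePoint.inner_blocker (h : NinePoint P c i p₁ p₂ p₃ p₄ m₁ m₂ m₃ m₄ x l₁ l₂ l₃ l₄)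
    {v w : ℝ × ℝ} (hv : v ∈ P) (hw : w ∈ P) (hvR : v ∈ quadRegion l₁ l₂ l₃ l₄)
    (hwR : w ∈ quadRegion l₁ l₂ l₃ l₄) (hvi : c v ≠ i) (hne : v ≠ w) (hvw : c v = c w) :
    ∃ z ∈ openSegment ℝ v w, c z ≠ c v ∧ (z = m₁ ∨ z = m₂ ∨ z = m₃ ∨ z = m₄ ∨ z = x) := by
  obtain ⟨z, hz, hzo, hzc⟩ := h.blocked.exists_blocker h.finite hv hw hne hvw
  exact ⟨z, hzo, hzc, h.complete z hz (convex_quadRegion.openSegment_subset hvR hwR hzo)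
    (h.frame.colour_ne_of_mem_openSegment h.vertex hvR hwR hvi hz hzo)⟩

lemma NinePoint.colour_adjacent (h : NinePoint P c i p₁ p₂ p₃ p₄ m₁ m₂ m₃ m₄ x l₁ l₂ l₃ l₄) :
    c m₁ ≠ c m₂ := by
  intro hcc
  obtain ⟨r₁, r₂, r₃⟩ := @NinePoint.region_rotations l₁ l₂ l₃ l₄
  obtain ⟨z, hzo, hzc, hz⟩ := h.inner_blocker h.mem₁ h.mem₂ h.side_mem_region
    (r₁ ▸ h.rotate.side_mem_region) h.ne₁ h.ne_m₁₂ hcc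
  obtain ⟨a₁, a₂, a₃, a₄⟩ := h.frame.side h.side₁
  obtain ⟨b₂, b₃, b₄, b₁⟩ := h.frame.rotate.side h.side₂
  rcases hz with rfl | rfl | rfl | rfl | rfl
  · exact hzc rfl
  · exact hzc hcc.symm
  · exact (l₃.neg_of_mem_openSegment hzo a₃.le b₃).ne (h.frame.rotate.rotate.side h.side₃).1
  · exact (l₄.neg_of_mem_openSegment hzo a₄.le b₄).ne
      (h.frame.rotate.rotate.rotate.side h.side₄).1
  · have e₁ := h.frame.sum p₃
    have e₂ := h.frame.sum m₂
    have f := h.frame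
    have key := (l₁ - l₄).eq_zero_of_mem_openSegment h.diag₁
      (by simp [f.z₁₁, f.z₄₁]) (by simp; linarith [f.z₂₃, f.z₃₃])
    have := (l₁ - l₄).pos_of_mem_openSegment hzo (by simp; linarith) (by simp; linarith)
    linarith

lemma NinePoint.colour_center (h : NinePoint P c i p₁ p₂ p₃ p₄ m₁ m₂ m₃ m₄ x l₁ l₂ l₃ l₄) :
    c m₁ ≠ c x := by
  intro hcc
  obtain ⟨a₁, a₂, a₃, a₄⟩ := h.frame.side h.side₁
  obtain ⟨b₁, b₂, b₃, b₄⟩ := h.frame.diagonal h.diag₁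
  obtain ⟨z, hzo, hzc, hz⟩ := h.inner_blocker h.mem₁ h.memₓ h.side_mem_region
    h.center_mem_region h.ne₁ (by rintro rfl; exact b₁.ne a₁) hcc
  rcases hz with rfl | rfl | rfl | rfl | rfl
  · exact hzc rfl
  · exact (l₂.neg_of_mem_openSegment hzo a₂.le b₂).ne (h.frame.rotate.side h.side₂).1
  · exact (l₃.neg_of_mem_openSegment hzo a₃.le b₃).ne (h.frame.rotate.rotate.side h.side₃).1
  · exact (l₄.neg_of_mem_openSegment hzo a₄.le b₄).ne
      (h.frame.rotate.rotate.rotate.side h.side₄).1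
  · exact hzc hcc.symm

lemma NinePoint.colour_opposite (h : NinePoint P c i p₁ p₂ p₃ p₄ m₁ m₂ m₃ m₄ x l₁ l₂ l₃ l₄) :
    c m₁ = c m₃ :=
  fin_four_eq i (c x) (c m₂) _ _ h.neₓ.symm h.ne₂.symm h.rotate.colour_center.symm h.ne₁
    h.colour_center h.colour_adjacent h.ne₃ h.rotate.rotate.colour_center
    h.rotate.colour_adjacent.symm

/-- The center blocks opposite side points. -/
lemma NinePoint.center_mem_openSegment
    (h : NinePoint P c i p₁ p₂ p₃ p₄ m₁ m₂ m₃ m₄ x l₁ l₂ l₃ l₄) : x ∈ openSegment ℝ m₁ m₃ := by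
  obtain ⟨r₁, r₂, r₃⟩ := @NinePoint.region_rotations l₁ l₂ l₃ l₄
  have hcc := h.colour_opposite
  obtain ⟨z, hzo, hzc, hz⟩ := h.inner_blocker h.mem₁ h.mem₃ h.side_mem_region
    (r₂ ▸ h.rotate.rotate.side_mem_region) h.ne₁ h.ne_m₁₃ hcc
  obtain ⟨a₁, a₂, a₃, a₄⟩ := h.frame.side h.side₁
  obtain ⟨b₃, b₄, b₁, b₂⟩ := h.frame.rotate.rotate.side h.side₃
  rcases hz with rfl | rfl | rfl | rfl | rfl
  · exact absurd rfl hzc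
  · exact absurd (h.frame.rotate.side h.side₂).1 (l₂.neg_of_mem_openSegment hzo a₂.le b₂).ne
  · exact absurd hcc.symm hzc
  · exact absurd (h.frame.rotate.rotate.rotate.side h.side₄).1
      (l₄.neg_of_mem_openSegment hzo a₄.le b₄).ne
  · exact hzo

lemma NinePoint.vertex_mem_region
    (h : NinePoint P c i p₁ p₂ p₃ p₄ m₁ m₂ m₃ m₄ x l₁ l₂ l₃ l₄) {q : ℝ × ℝ} (hq : q ∈ P)
    (hqi : c q = i) : q ∈ quadRegion l₁ l₂ l₃ l₄ := by
  obtain ⟨r₁, r₂, r₃⟩ := @NinePoint.region_rotations l₁ l₂ l₃ l₄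
  rcases (h.vertex q).1 ⟨hq, hqi⟩ with rfl | rfl | rfl | rfl
  · exact h.frame.mem_region
  · exact r₁ ▸ h.frame.rotate.mem_region
  · exact r₂ ▸ h.frame.rotate.rotate.mem_region
  · exact r₃ ▸ h.frame.rotate.rotate.rotate.mem_region

lemma NinePoint.eq_of_mem_region
    (h : NinePoint P c i p₁ p₂ p₃ p₄ m₁ m₂ m₃ m₄ x l₁ l₂ l₃ l₄) {q : ℝ × ℝ} (hq : q ∈ P)
    (hqR : q ∈ quadRegion l₁ l₂ l₃ l₄) : (q = p₁ ∨ q = p₂ ∨ q = p₃ ∨ q = p₄) ∨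
      q = m₁ ∨ q = m₂ ∨ q = m₃ ∨ q = m₄ ∨ q = x := by
  by_cases hqi : c q = i
  · exact Or.inl ((h.vertex q).1 ⟨hq, hqi⟩)
  · exact Or.inr (h.complete q hq hqR hqi)

lemma NinePoint.colour_ne_center_of_notMem
    (h : NinePoint P c i p₁ p₂ p₃ p₄ m₁ m₂ m₃ m₄ x l₁ l₂ l₃ l₄) {y : ℝ × ℝ} (hy : y ∈ P)
    (hyR : y ∉ quadRegion l₁ l₂ l₃ l₄)
    (hseg : ∀ z ∈ P, ∀ w ∈ quadRegion l₁ l₂ l₃ l₄, z ∈ openSegment ℝ y w →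
      z ∈ quadRegion l₁ l₂ l₃ l₄) : c y ≠ c x := by
  intro hcc
  have hne : y ≠ x := by rintro rfl; exact hyR h.center_mem_region
  obtain ⟨z, hz, hzo, hzc⟩ := h.blocked.exists_blocker h.finite hy h.memₓ hne hcc
  have overlap {w} (hw : w ∈ P) (hx : x ∈ openSegment ℝ z w) : False :=
    h.blocked.not_overlap h.finite hy hz h.memₓ hw hne hzo hx
  have mem₁ := ((h.vertex p₁).2 (by simp)).1
  have mem₂ := ((h.vertex p₂).2 (by simp)).1
  have mem₃ := ((h.vertex p₃).2 (by simp)).1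
  have mem₄ := ((h.vertex p₄).2 (by simp)).1
  rcases h.eq_of_mem_region hz (hseg z hz x h.center_mem_region hzo) with
    (rfl | rfl | rfl | rfl) | rfl | rfl | rfl | rfl | rfl
  · exact overlap mem₃ h.diag₁
  · exact overlap mem₄ h.diag₂
  · exact overlap mem₁ h.rotate.rotate.diag₁
  · exact overlap mem₂ h.rotate.rotate.diag₂
  · exact overlap h.mem₃ h.center_mem_openSegment
  · exact overlap h.mem₄ h.rotate.center_mem_openSegment
  · exact overlap h.mem₁ h.rotate.rotate.center_mem_openSegment
  · exact overlap h.mem₂ h.rotate.rotate.rotate.center_mem_openSegment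
  · exact hzc hcc.symm

/-- The position of an outer point `y` relative to the quadrilateral if `z` blocks `y` and `m₁`. -/
lemma NinePoint.sides_of_blocker
    (h : NinePoint P c i p₁ p₂ p₃ p₄ m₁ m₂ m₃ m₄ x l₁ l₂ l₃ l₄) {y z : ℝ × ℝ} (hy : y ∈ P)
    (hyR : y ∉ quadRegion l₁ l₂ l₃ l₄) (hz : z ∈ P) (hzR : z ∈ quadRegion l₁ l₂ l₃ l₄)
    (hzo : z ∈ openSegment ℝ y m₁) (hzc : c z ≠ c m₁) :
    l₁ y < 0 ∧ (0 < l₃ y ∨ (z = m₂ ∧ 0 < l₂ y) ∨ (z = m₄ ∧ 0 < l₄ y)) := by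
  obtain ⟨r₁, r₂, r₃⟩ := @NinePoint.region_rotations l₁ l₂ l₃ l₄
  obtain ⟨a₁, a₂, a₃, a₄⟩ := h.frame.side h.side₁
  have hne : y ≠ m₁ := by rintro rfl; exact hyR h.side_mem_region
  have f := h.frame
  have overlap {w} (hw : w ∈ P) (hx : m₁ ∈ openSegment ℝ z w) : False :=
    h.blocked.not_overlap h.finite hy hz h.mem₁ hw hne hzo hx
  rcases h.eq_of_mem_region hz hzR with
    (rfl | rfl | rfl | rfl) | rfl | rfl | rfl | rfl | rfl
  · exact (overlap ((h.vertex p₂).2 (by simp)).1 h.side₁).elim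
  · exact (overlap ((h.vertex p₁).2 (by simp)).1
      (by rw [openSegment_symm]; exact h.side₁)).elim
  · exact ⟨l₁.left_neg_of_mem_openSegment hzo f.n₁₃ a₁,
      Or.inl (l₃.left_pos_of_mem_openSegment hzo f.z₃₃ a₃)⟩
  · exact ⟨l₁.left_neg_of_mem_openSegment hzo f.n₁₄ a₁,
      Or.inl (l₃.left_pos_of_mem_openSegment hzo f.z₃₄ a₃)⟩
  · exact absurd rfl hzc
  · obtain ⟨b₂, -, -, b₁⟩ := f.rotate.side h.side₂
    exact ⟨l₁.left_neg_of_mem_openSegment hzo b₁ a₁,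
      Or.inr (Or.inl ⟨rfl, l₂.left_pos_of_mem_openSegment hzo b₂ a₂⟩)⟩
  · exact absurd h.colour_opposite.symm hzc
  · obtain ⟨b₄, b₁, -, -⟩ := f.rotate.rotate.rotate.side h.side₄
    exact ⟨l₁.left_neg_of_mem_openSegment hzo b₁ a₁,
      Or.inr (Or.inr ⟨rfl, l₄.left_pos_of_mem_openSegment hzo b₄ a₄⟩)⟩
  · have := h.blocked.eq_of_mem_openSegment h.finite h.mem₁ h.memₓ hy h.mem₃
      (by rintro rfl; exact hzc rfl) hzo h.rotate.rotate.center_mem_openSegment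
    exact (hyR (this ▸ r₂ ▸ h.rotate.rotate.side_mem_region)).elim

lemma NinePoint.colour_ne_side_of_notMem
    (h : NinePoint P c i p₁ p₂ p₃ p₄ m₁ m₂ m₃ m₄ x l₁ l₂ l₃ l₄) {y : ℝ × ℝ} (hy : y ∈ P)
    (hyR : y ∉ quadRegion l₁ l₂ l₃ l₄)
    (hseg : ∀ z ∈ P, ∀ w ∈ quadRegion l₁ l₂ l₃ l₄, z ∈ openSegment ℝ y w →
      z ∈ quadRegion l₁ l₂ l₃ l₄) : c y ≠ c m₁ := by
  intro hcc
  obtain ⟨r₁, r₂, r₃⟩ := @NinePoint.region_rotations l₁ l₂ l₃ l₄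
  have hR₁ := h.side_mem_region
  have hR₃ : m₃ ∈ quadRegion l₁ l₂ l₃ l₄ := r₂ ▸ h.rotate.rotate.side_mem_region
  have hcc' := hcc.trans h.colour_opposite
  obtain ⟨z, hz, hzo, hzc⟩ := h.blocked.exists_blocker h.finite hy h.mem₁
    (by rintro rfl; exact hyR hR₁) hcc
  obtain ⟨w, hw, hwo, hwc⟩ := h.blocked.exists_blocker h.finite hy h.mem₃
    (by rintro rfl; exact hyR hR₃) hcc'
  obtain ⟨hl₁, hz'⟩ := h.sides_of_blocker hy hyR hz (hseg z hz _ hR₁ hzo) hzo (hcc ▸ hzc)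
  obtain ⟨hl₃, hw'⟩ := h.rotate.rotate.sides_of_blocker hy (r₂.symm ▸ hyR) hw
    (r₂.symm ▸ hseg w hw _ hR₃ hwo) hwo (hcc' ▸ hwc)
  have hzw : z ≠ w := by
    rintro rfl
    rw [openSegment_symm] at hzo hwo
    exact h.ne_m₁₃ (h.blocked.eq_of_mem_openSegment h.finite hy hz h.mem₁ h.mem₃
      (by rintro rfl; exact hzc rfl) hzo hwo)
  have hsum := h.frame.sum y
  rcases hz' with hz' | ⟨rfl, hz'⟩ | ⟨rfl, hz'⟩ <;>
    rcases hw' with hw' | ⟨rfl, hw'⟩ | ⟨rfl, hw'⟩ <;>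
    first | exact hzw rfl | linarith

/-- All points lie in the quadrilateral. -/
lemma NinePoint.mem_region (h : NinePoint P c i p₁ p₂ p₃ p₄ m₁ m₂ m₃ m₄ x l₁ l₂ l₃ l₄)
    {q : ℝ × ℝ} (hq : q ∈ P) : q ∈ quadRegion l₁ l₂ l₃ l₄ := by
  obtain ⟨r₁, r₂, r₃⟩ := @NinePoint.region_rotations l₁ l₂ l₃ l₄
  by_contra hqR
  let φ : ℝ × ℝ → ℝ := fun p => max (max (l₁ p) (l₂ p)) (max (l₃ p) (l₄ p))
  have hφ {p} {t : ℝ} : φ p < t ↔ l₁ p < t ∧ l₂ p < t ∧ l₃ p < t ∧ l₄ p < t := by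
    simp only [φ, max_lt_iff, and_assoc]
  have hφR {p} : p ∈ quadRegion l₁ l₂ l₃ l₄ ↔ φ p ≤ 0 := by
    simp only [φ, max_le_iff, and_assoc]; rfl
  have hφl (p) : l₁ p ≤ φ p ∧ l₂ p ≤ φ p ∧ l₃ p ≤ φ p ∧ l₄ p ≤ φ p := by simp [φ]
  obtain ⟨y, ⟨hy, hyR⟩, hmin⟩ := Set.exists_min_image {p | p ∈ P ∧ p ∉ quadRegion l₁ l₂ l₃ l₄} φ
    (h.finite.subset fun p hp => hp.1) ⟨q, hq, hqR⟩
  have hpos : 0 < φ y := not_le.1 (hφR.not.1 hyR)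
  have hseg : ∀ z ∈ P, ∀ w ∈ quadRegion l₁ l₂ l₃ l₄, z ∈ openSegment ℝ y w →
      z ∈ quadRegion l₁ l₂ l₃ l₄ := by
    intro z hz w ⟨w₁, w₂, w₃, w₄⟩ hzo
    by_contra hzR
    have lower (l : ℝ × ℝ →ᵃ[ℝ] ℝ) (hly : l y ≤ φ y) (hlw : l w ≤ 0) : l z < φ y := by
      obtain ⟨α, β, hα, hβ, hαβ, rfl⟩ := hzo
      rw [Convex.combo_affine_apply hαβ, smul_eq_mul, smul_eq_mul]
      nlinarith
    obtain ⟨y₁, y₂, y₃, y₄⟩ := hφl y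
    exact (hmin z ⟨hz, hzR⟩).not_gt
      (hφ.2 ⟨lower _ y₁ w₁, lower _ y₂ w₂, lower _ y₃ w₃, lower _ y₄ w₄⟩)
  have c₂ := h.rotate.colour_ne_side_of_notMem hy (r₁.symm ▸ hyR) (by simpa only [r₁] using hseg)
  exact h.colour_ne_side_of_notMem hy hyR hseg (fin_four_eq i (c x) (c m₂) (c y) (c m₁)
    h.neₓ.symm h.ne₂.symm h.rotate.colour_center.symm
    (fun hyi => hyR (h.vertex_mem_region hy hyi)) (h.colour_ne_center_of_notMem hy hyR hseg) c₂
    h.ne₁ h.colour_center h.colour_adjacent)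

end NinePoints

section Construction

variable {P : Set (ℝ × ℝ)} {c : ℝ × ℝ → Fin 4} {i : Fin 4}
  {p₁ p₂ p₃ p₄ m₁ m₂ m₃ m₄ x : ℝ × ℝ} {l₁ l₂ l₃ l₄ : ℝ × ℝ →ᵃ[ℝ] ℝ}

lemma QuadFrame.ne_side (h : QuadFrame p₁ p₂ p₃ p₄ l₁ l₂ l₃ l₄) : p₁ ≠ p₂ := by
  rintro rfl
  exact h.n₂₁.ne h.z₂₂

lemma QuadFrame.ne_diagonal (h : QuadFrame p₁ p₂ p₃ p₄ l₁ l₂ l₃ l₄) : p₁ ≠ p₃ := by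
  rintro rfl
  exact h.n₁₃.ne h.z₁₁

/-- The points of the quadrilateral that are not vertices form a blocked set. -/
lemma QuadFrame.blockedColouring_region (h : QuadFrame p₁ p₂ p₃ p₄ l₁ l₂ l₃ l₄)
    (hvert : ∀ q, q ∈ P ∧ c q = i ↔ q = p₁ ∨ q = p₂ ∨ q = p₃ ∨ q = p₄)
    (hc : BlockedColouring P c) :
    BlockedColouring {q | q ∈ P ∧ q ∈ quadRegion l₁ l₂ l₃ l₄ ∧ c q ≠ i} c := by
  rintro v ⟨hv, hvR, hvi⟩ w ⟨hw, hwR, -⟩ hne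
  rw [← hc v hv w hw hne]
  exact ⟨fun hvis z hz hzo => hvis z ⟨hz, convex_quadRegion.openSegment_subset hvR hwR hzo,
    h.colour_ne_of_mem_openSegment hvert hvR hwR hvi hz hzo⟩ hzo, fun hvis z hz => hvis z hz.1⟩

/-- A blocked set with a colour class in convex position of size four contains the
configuration described by `NinePoint`. -/
lemma BlockedColouring.exists_ninePoint (hP : P.Finite) (hc : BlockedColouring P c)
    (h4 : (P ∩ c ⁻¹' {i}).ncard = 4) (hconv : ConvexPosition (P ∩ c ⁻¹' {i})) :
    ∃ p₁ p₂ p₃ p₄ m₁ m₂ m₃ m₄ x l₁ l₂ l₃ l₄,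
      NinePoint P c i p₁ p₂ p₃ p₄ m₁ m₂ m₃ m₄ x l₁ l₂ l₃ l₄ := by
  obtain ⟨p₁, p₂, p₃, p₄, z, hK, h₁₂, h₁₃, h₂₃, hz, hz'⟩ := hconv.exists_crossing h4
  have hvert (q) : q ∈ P ∧ c q = i ↔ q = p₁ ∨ q = p₂ ∨ q = p₃ ∨ q = p₄ := by
    simpa using Set.ext_iff.1 hK q
  obtain ⟨k₁, i₁⟩ := (hvert p₁).2 (by simp)
  obtain ⟨k₂, i₂⟩ := (hvert p₂).2 (by simp)
  obtain ⟨k₃, i₃⟩ := (hvert p₃).2 (by simp)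
  obtain ⟨k₄, i₄⟩ := (hvert p₄).2 (by simp)
  obtain ⟨l₁, l₂, l₃, l₄, f⟩ := exists_quadFrame hz hz'
    (hc.signedArea_ne_zero hP k₁ k₂ k₃ h₁₂ h₁₃ h₂₃ (i₁.trans i₂.symm) (i₁.trans i₃.symm))
  have blocker {v w} (hv : v ∈ P) (hw : w ∈ P) (hvi : c v = i) (hwi : c w = i) (hne : v ≠ w) :
      ∃ m ∈ P, m ∈ openSegment ℝ v w ∧ c m ≠ i := by
    obtain ⟨m, hm, hmo, hmc⟩ := hc.exists_blocker hP hv hw hne (hvi.trans hwi.symm)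
    exact ⟨m, hm, hmo, hvi ▸ hmc⟩
  obtain ⟨m₁, hm₁, s₁, n₁⟩ := blocker k₁ k₂ i₁ i₂ f.ne_side
  obtain ⟨m₂, hm₂, s₂, n₂⟩ := blocker k₂ k₃ i₂ i₃ f.rotate.ne_side
  obtain ⟨m₃, hm₃, s₃, n₃⟩ := blocker k₃ k₄ i₃ i₄ f.rotate.rotate.ne_side
  obtain ⟨m₄, hm₄, s₄, n₄⟩ := blocker k₄ k₁ i₄ i₁ f.rotate.rotate.rotate.ne_side
  obtain ⟨x, hx, d₁, nx⟩ := blocker k₁ k₃ i₁ i₃ f.ne_diagonal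
  obtain ⟨y, hy, d₂, ny⟩ := blocker k₂ k₄ i₂ i₄ f.rotate.ne_diagonal
  obtain ⟨a₁, a₂, a₃, a₄⟩ := f.side s₁
  obtain ⟨b₂, b₃, b₄, b₁⟩ := f.rotate.side s₂
  obtain ⟨c₃, c₄, c₁, c₂⟩ := f.rotate.rotate.side s₃
  obtain ⟨e₄, e₁, e₂, e₃⟩ := f.rotate.rotate.rotate.side s₄
  obtain ⟨x₁, x₂, x₃, x₄⟩ := f.diagonal d₁
  obtain ⟨y₂, y₃, y₄, y₁⟩ := f.rotate.diagonal d₂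
  have ne {l : ℝ × ℝ →ᵃ[ℝ] ℝ} {p q} (hp : l p = 0) (hq : l q < 0) : q ≠ p := by
    rintro rfl; exact hq.ne hp
  let Q := {q | q ∈ P ∧ q ∈ quadRegion l₁ l₂ l₃ l₄ ∧ c q ≠ i}
  have hQ : Q.Finite := hP.subset fun q hq => hq.1
  let F : Finset (ℝ × ℝ) := {m₁, m₂, m₃, m₄}
  have hF : F.card = 4 := by
    simp [F, Finset.card_insert_of_notMem, (ne a₁ b₁).symm, (ne a₁ c₁).symm, (ne a₁ e₁).symm,
      (ne b₂ c₂).symm, (ne b₂ e₂).symm, (ne c₃ e₃).symm]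
  have hFQ : ∀ p ∈ F, p ∈ Q := by
    simp only [F, Finset.mem_insert, Finset.mem_singleton]
    rintro p (rfl | rfl | rfl | rfl)
    · exact ⟨hm₁, ⟨a₁.le, a₂.le, a₃.le, a₄.le⟩, n₁⟩
    · exact ⟨hm₂, ⟨b₁.le, b₂.le, b₃.le, b₄.le⟩, n₂⟩
    · exact ⟨hm₃, ⟨c₁.le, c₂.le, c₃.le, c₄.le⟩, n₃⟩
    · exact ⟨hm₄, ⟨e₁.le, e₂.le, e₃.le, e₄.le⟩, n₄⟩
  have hexp : StrictlyExposed F := by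
    simp only [StrictlyExposed, F, Finset.mem_insert, Finset.mem_singleton]
    rintro p (rfl | rfl | rfl | rfl)
    · refine ⟨l₁, a₁, ?_⟩
      rintro q (rfl | rfl | rfl | rfl) h <;> first | assumption | exact (h rfl).elim
    · refine ⟨l₂, b₂, ?_⟩
      rintro q (rfl | rfl | rfl | rfl) h <;> first | assumption | exact (h rfl).elim
    · refine ⟨l₃, c₃, ?_⟩
      rintro q (rfl | rfl | rfl | rfl) h <;> first | assumption | exact (h rfl).elim
    · refine ⟨l₄, e₄, ?_⟩
      rintro q (rfl | rfl | rfl | rfl) h <;> first | assumption | exact (h rfl).elim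
  have hcard : Q.ncard ≤ 5 := (f.blockedColouring_region hvert hc).card_le_five hQ
    (fun q hq => hq.2.2) hFQ hexp hF
  have hxQ : x ∈ Q := ⟨hx, ⟨x₁.le, x₂.le, x₃.le, x₄.le⟩, nx⟩
  have hyQ : y ∈ Q := ⟨hy, ⟨y₁.le, y₂.le, y₃.le, y₄.le⟩, ny⟩
  have hxF : x ∉ F := by simp [F, ne a₁ x₁, ne b₂ x₂, ne c₃ x₃, ne e₄ x₄]
  have hsub : ((insert x F : Finset (ℝ × ℝ)) : Set (ℝ × ℝ)) ⊆ Q := by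
    intro q hq
    rcases Finset.mem_insert.1 (Finset.mem_coe.1 hq) with rfl | hq
    exacts [hxQ, hFQ q hq]
  have heq := Set.eq_of_subset_of_ncard_le hsub
    (by rw [Set.ncard_coe_finset, Finset.card_insert_of_notMem hxF, hF]; exact hcard) hQ
  have hall {q} (hq : q ∈ Q) : q = x ∨ q = m₁ ∨ q = m₂ ∨ q = m₃ ∨ q = m₄ := by
    simpa [F] using heq.symm.subset hq
  obtain rfl : y = x := (hall hyQ).resolve_right
    (by simp [ne a₁ y₁, ne b₂ y₂, ne c₃ y₃, ne e₄ y₄])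
  exact ⟨p₁, p₂, p₃, p₄, m₁, m₂, m₃, m₄, y, l₁, l₂, l₃, l₄,
    { finite := hP
      blocked := hc
      frame := f
      vertex := hvert
      mem₁ := hm₁
      mem₂ := hm₂
      mem₃ := hm₃
      mem₄ := hm₄
      memₓ := hx
      side₁ := s₁
      side₂ := s₂
      side₃ := s₃
      side₄ := s₄
      diag₁ := d₁
      diag₂ := d₂
      ne₁ := n₁
      ne₂ := n₂
      ne₃ := n₃
      ne₄ := n₄
      neₓ := nx
      complete := fun q hq hR hi => by have := hall ⟨hq, hR, hi⟩; tauto }⟩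

/-- The colour class of two opposite side points. -/
lemma NinePoint.class_side (h : NinePoint P c i p₁ p₂ p₃ p₄ m₁ m₂ m₃ m₄ x l₁ l₂ l₃ l₄) :
    (P ∩ c ⁻¹' {c m₁}).ncard = 2 := by
  rw [← Set.ncard_pair h.ne_m₁₃]
  congr 1
  ext q
  simp only [Set.mem_inter_iff, Set.mem_preimage, Set.mem_singleton_iff, Set.mem_insert_iff]
  refine ⟨fun ⟨hq, hqc⟩ => ?_, ?_⟩
  · rcases h.complete q hq (h.mem_region hq) (hqc ▸ h.ne₁) with rfl | rfl | rfl | rfl | rfl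
    · exact Or.inl rfl
    · exact absurd hqc.symm h.colour_adjacent
    · exact Or.inr rfl
    · exact absurd hqc h.rotate.rotate.rotate.colour_adjacent
    · exact absurd hqc.symm h.colour_center
  · rintro (rfl | rfl)
    exacts [⟨h.mem₁, rfl⟩, ⟨h.mem₃, h.colour_opposite.symm⟩]

lemma NinePoint.class_center (h : NinePoint P c i p₁ p₂ p₃ p₄ m₁ m₂ m₃ m₄ x l₁ l₂ l₃ l₄) :
    (P ∩ c ⁻¹' {c x}).ncard = 1 := by
  rw [Set.ncard_eq_one]
  refine ⟨x, Set.ext fun q => ?_⟩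
  simp only [Set.mem_inter_iff, Set.mem_preimage, Set.mem_singleton_iff]
  refine ⟨fun ⟨hq, hqc⟩ => ?_, by rintro rfl; exact ⟨h.memₓ, rfl⟩⟩
  rcases h.complete q hq (h.mem_region hq) (hqc ▸ h.neₓ) with rfl | rfl | rfl | rfl | rfl
  · exact absurd hqc h.colour_center
  · exact absurd hqc h.rotate.colour_center
  · exact absurd hqc h.rotate.rotate.colour_center
  · exact absurd hqc h.rotate.rotate.rotate.colour_center
  · rfl

end Construction

/-- If some colour class of a 4-blocked set `P` consists of exactly four points in
convex position, then `P` is `{4,2,2,1}`-blocked. -/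
theorem convex_class_4221 (P : Set (ℝ × ℝ)) (hfin : P.Finite)
    (c : (ℝ × ℝ) → Fin 4) (hc : BlockedColouring P c)
    (i : Fin 4) (h4 : (P ∩ c ⁻¹' {i}).ncard = 4)
    (hconv : ConvexPosition (P ∩ c ⁻¹' {i})) :
    IsNBlocked ({4, 2, 2, 1} : Multiset ℕ) P := by
  obtain ⟨p₁, p₂, p₃, p₄, m₁, m₂, m₃, m₄, x, l₁, l₂, l₃, l₄, h⟩ :=
    hc.exists_ninePoint hfin h4 hconv
  have huniv : (Finset.univ : Finset (Fin 4)).val = {i, c m₁, c m₂, c x} := by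
    have key : ∀ i j k l : Fin 4, i ≠ j → i ≠ k → i ≠ l → j ≠ k → j ≠ l → k ≠ l →
        (Finset.univ : Finset (Fin 4)).val = {i, j, k, l} := by decide
    exact key _ _ _ _ h.ne₁.symm h.ne₂.symm h.neₓ.symm h.colour_adjacent h.colour_center
      h.rotate.colour_center
  refine ⟨hfin, 4, c, hc, ?_⟩
  simp [huniv, h4, h.class_side, h.rotate.class_side, h.class_center]
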